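/- Let V be a finite-dimensional real vector space equipped with a Lorentzian symmetric bilinear form B, and let ρ : sl(2,ℝ) → End(V) be an injective Lie algebra homomorphism whose image consists of endomorphisms skew-adjoint with respect to B. If V is irreducible as an sl(2,ℝ)-module via ρ, then dim V = 3. -/

import Mathlib

open Module

attribute [local instance 100] LieRing.ofAssociativeRing

/-- A symmetric bilinear form on a finite-dimensional real vector space is *Lorentzian* if
some basis puts it in the form `diag(-1, 1, …, 1)`. -/
def IsLorentzian {V : Type*} [AddCommGroup V] [Module ℝ V]
    (B : LinearMap.BilinForm ℝ V) : Prop :=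
  ∃ b : Basis (Fin (finrank ℝ V)) ℝ V,
    ∀ i j, B (b i) (b j) = if i = j then (if (i : ℕ) = 0 then (-1 : ℝ) else 1) else 0

theorem lor_zero {V : Type*} [AddCommGroup V] [Module ℝ V]
    (B : LinearMap.BilinForm ℝ V) (b : Basis (Fin (finrank ℝ V)) ℝ V)
    (hb : ∀ i j, B (b i) (b j) = if i = j then (if (i : ℕ) = 0 then (-1 : ℝ) else 1) else 0)
    (u : V) (h0 : ∀ i : Fin (finrank ℝ V), (i : ℕ) = 0 → b.repr u i = 0) (hu : B u u = 0) : u = 0 := by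
  have key : B u u = ∑ i, (b.repr u i) ^ 2 := by
    conv_lhs => rw [← b.sum_repr u]
    simp only [map_sum, map_smul, LinearMap.sum_apply, LinearMap.smul_apply, hb, smul_eq_mul]
    refine Finset.sum_congr rfl fun i _ => ?_
    rw [Finset.sum_eq_single i]
    · by_cases hi : (i : ℕ) = 0
      · simp [h0 i hi]
      · simp [hi, sq]
    · intro j _ hj
      simp [hj]
    · simp
  rw [key, Finset.sum_eq_zero_iff_of_nonneg (fun i _ => sq_nonneg _)] at hu
  apply b.repr.injective
  ext i
  simpa using hu i (Finset.mem_univ i)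

theorem lor_iso {V : Type*} [AddCommGroup V] [Module ℝ V]
    (hdim : 2 ≤ finrank ℝ V)
    (B : LinearMap.BilinForm ℝ V) (hB : IsLorentzian B) (x y : V) (hx : B x x = 0)
    (hy : B y y = 0) (hxy : B x y = 0) (hyx : B y x = 0) (hx0 : x ≠ 0) : ∃ c : ℝ, y = c • x := by
  obtain ⟨b, hb⟩ := hB
  let o : Fin (finrank ℝ V) := ⟨0, by omega⟩
  have hxo : b.repr x o ≠ 0 := by
    intro h
    refine hx0 (lor_zero B b hb x (fun i hi => ?_) hx)
    have : i = o := Fin.ext hi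
    rw [this, h]
  have hz := lor_zero B b hb (b.repr x o • y - b.repr y o • x) (fun i hi => ?_)
    (by simp [hx, hy, hxy, hyx])
  · refine ⟨(b.repr x o)⁻¹ * b.repr y o, ?_⟩
    rw [mul_smul, ← sub_eq_zero.mp hz, smul_smul, inv_mul_cancel₀ hxo, one_smul]
  · have : i = o := Fin.ext hi
    rw [this]
    simp [mul_comm]

theorem comm_pow_aux {V : Type*} [AddCommGroup V] [Module ℝ V] (H E : Module.End ℝ V) (c : ℝ)
    (h : H * E - E * H = c • E) (k : ℕ) : H * E ^ k - E ^ k * H = (k * c) • E ^ k := by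
  induction k with
  | zero => simp
  | succ k ih =>
    have : H * E ^ (k + 1) - E ^ (k + 1) * H
        = (H * E ^ k - E ^ k * H) * E + E ^ k * (H * E - E * H) := by
      rw [pow_succ]; noncomm_ring
    rw [this, ih, h, smul_mul_assoc, mul_smul_comm, ← pow_succ, ← add_smul]
    push_cast
    ring_nf

theorem nilp_aux {V : Type*} [AddCommGroup V] [Module ℝ V] [FiniteDimensional ℝ V]
    (H E : Module.End ℝ V) (c : ℝ) (hc : c ≠ 0)
    (h : H * E - E * H = c • E) : ∃ k : ℕ, E ^ k = 0 := by
  by_contra! hne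
  have := Module.End.eigenvectors_linearIndependent'
    (LinearMap.mulLeft ℝ H - LinearMap.mulRight ℝ H) (fun k : ℕ => (k * c : ℝ))
    (fun a b hab => by simpa [hc] using hab) (fun k => E ^ k)
    (fun k => ⟨by
      rw [Module.End.mem_eigenspace_iff]
      simpa using comm_pow_aux H E c h k, hne k⟩)
  exact Set.infinite_univ (α := ℕ) (by
    have := this.finite
    exact Set.finite_univ)

theorem ef_aux {V : Type*} [AddCommGroup V] [Module ℝ V]
    (H E F : Module.End ℝ V) (hEF : E * F - F * E = H)
    (hHF : H * F - F * H = (-2 : ℝ) • F) (w : V) (hw : E w = 0) (k : ℕ) :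
    E ((F ^ (k + 1)) w) = ((k + 1 : ℝ)) • (F ^ k) (H w - (k : ℝ) • w) := by
  have hef : ∀ x, E (F x) = F (E x) + H x := fun x => by
    rw [← hEF]; simp
  induction k with
  | zero => simp [hef, hw]
  | succ k ih =>
    have h1 : H ((F ^ (k + 1)) w) = (F ^ (k + 1)) (H w) + (((k + 1 : ℕ) : ℝ) * (-2)) • (F ^ (k + 1)) w := by
      have := congrArg (fun T : Module.End ℝ V => T w) (comm_pow_aux H F (-2) hHF (k + 1))
      simp only [LinearMap.sub_apply, Module.End.mul_apply, LinearMap.smul_apply] at this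
      rw [← this]; abel
    have h2 : ∀ x, F ((F ^ k) x) = (F ^ (k + 1)) x := fun x => by
      rw [pow_succ']; rfl
    have h3 : (F ^ (k + 1 + 1)) w = F ((F ^ (k + 1)) w) := by
      rw [pow_succ' F (k + 1)]; rfl
    rw [h3, hef, ih, h1, map_smul, h2]
    simp only [map_sub, map_smul]
    push_cast
    module

theorem prim_aux {V : Type*} [AddCommGroup V] [Module ℝ V]
    (H E F : Module.End ℝ V) (hEF : E * F - F * E = H) (hHE : H * E - E * H = (2 : ℝ) • E)
    (hHF : H * F - F * H = (-2 : ℝ) • F) (k : ℕ) :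
    ∀ w : V, w ≠ 0 → E w = 0 → (F ^ k) w = 0 → ∃ (v : V) (μ : ℝ), v ≠ 0 ∧ E v = 0 ∧ H v = μ • v := by
  induction k with
  | zero => intro w hw _ h; simp at h; exact absurd h hw
  | succ k ih =>
    intro w hw hE hF
    by_cases hz : H w - (k : ℝ) • w = 0
    · exact ⟨w, k, hw, hE, sub_eq_zero.mp hz⟩
    · refine ih _ hz ?_ ?_
      · have := congrArg (fun T : Module.End ℝ V => T w) hHE
        simp [hE] at this
        simp [hE, this]
      · have := ef_aux H E F hEF hHF w hE k
        rw [hF, map_zero] at this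
        exact (smul_eq_zero.mp this.symm).resolve_left (by positivity)

/-- If `ρ : sl(2,ℝ) → End(V)` is an injective Lie algebra homomorphism into the
endomorphisms of a finite-dimensional real vector space carrying a Lorentzian symmetric
bilinear form `B`, the image of `ρ` consists of `B`-skew-adjoint endomorphisms, and `V` is
irreducible as an `sl(2,ℝ)`-module, then `dim V = 3`. -/
theorem lorentz_irreducible_sl2_rep_dim_three {V : Type*} [AddCommGroup V] [Module ℝ V]
    [FiniteDimensional ℝ V] (hdim : 2 ≤ finrank ℝ V)
    (B : LinearMap.BilinForm ℝ V) (hsymm : B.IsSymm) (hB : IsLorentzian B)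
    (ρ : LieAlgebra.SpecialLinear.sl (Fin 2) ℝ →ₗ⁅ℝ⁆ Module.End ℝ V)
    (hinj : Function.Injective ρ)
    (hskew : ∀ A : LieAlgebra.SpecialLinear.sl (Fin 2) ℝ, ∀ u v : V,
      B (ρ A u) v + B u (ρ A v) = 0)
    (hirr : ∀ W : Submodule ℝ V,
      (∀ A : LieAlgebra.SpecialLinear.sl (Fin 2) ℝ, ∀ w ∈ W, ρ A w ∈ W) → W = ⊥ ∨ W = ⊤) :
    finrank ℝ V = 3 := by
  have hV : Nontrivial V := Module.nontrivial_of_finrank_pos (R := ℝ) (by omega)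
  let e : LieAlgebra.SpecialLinear.sl (Fin 2) ℝ := ⟨!![0, 1; 0, 0], by
    rw [LieAlgebra.SpecialLinear.sl, LieSubalgebra.mem_mk_iff']; simp [Matrix.trace]⟩
  let f : LieAlgebra.SpecialLinear.sl (Fin 2) ℝ := ⟨!![0, 0; 1, 0], by
    rw [LieAlgebra.SpecialLinear.sl, LieSubalgebra.mem_mk_iff']; simp [Matrix.trace]⟩
  let h : LieAlgebra.SpecialLinear.sl (Fin 2) ℝ := ⟨!![1, 0; 0, -1], by
    rw [LieAlgebra.SpecialLinear.sl, LieSubalgebra.mem_mk_iff']; simp [Matrix.trace]⟩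
  have hef : ⁅e, f⁆ = h := by
    apply Subtype.ext
    rw [LieAlgebra.SpecialLinear.sl_bracket]
    ext i j; fin_cases i <;> fin_cases j <;> simp [e, f, h]
  have hhe : ⁅h, e⁆ = (2 : ℝ) • e := by
    apply Subtype.ext
    rw [LieAlgebra.SpecialLinear.sl_bracket]
    ext i j; fin_cases i <;> fin_cases j <;> norm_num [e, f, h]
  have hhf : ⁅h, f⁆ = (-2 : ℝ) • f := by
    apply Subtype.ext
    rw [LieAlgebra.SpecialLinear.sl_bracket]
    ext i j; fin_cases i <;> fin_cases j <;> norm_num [e, f, h]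
  have hdec : ∀ A : LieAlgebra.SpecialLinear.sl (Fin 2) ℝ,
      ∃ a b c : ℝ, A = a • h + b • e + c • f := by
    intro A
    refine ⟨A.1 0 0, A.1 0 1, A.1 1 0, ?_⟩
    have htr : A.1 0 0 + A.1 1 1 = 0 := by
      have : Matrix.trace A.1 = 0 := A.2
      simpa [Matrix.trace] using this
    apply Subtype.ext
    ext i j; fin_cases i <;> fin_cases j <;> simp [e, f, h] <;> linarith
  have hne : h ≠ 0 := by
    intro hh
    have := congrArg (fun A : LieAlgebra.SpecialLinear.sl (Fin 2) ℝ => A.1 0 0) hh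
    simp [h] at this
  obtain ⟨H, hH⟩ : ∃ H, H = ρ h := ⟨_, rfl⟩
  obtain ⟨E, hE⟩ : ∃ H, H = ρ e := ⟨_, rfl⟩
  obtain ⟨F, hF⟩ : ∃ H, H = ρ f := ⟨_, rfl⟩
  have hEF : E * F - F * E = H := by
    rw [hE, hF, hH, ← hef, LieHom.map_lie]; rfl
  have hHE : H * E - E * H = (2 : ℝ) • E := by
    rw [hE, hH, ← map_smul, ← hhe, LieHom.map_lie]; rfl
  have hHF : H * F - F * H = (-2 : ℝ) • F := by
    rw [hF, hH, ← map_smul, ← hhf, LieHom.map_lie]; rfl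
  have hH0 : H ≠ 0 := by
    rw [hH]; intro h0; exact hne (hinj (by rw [h0, map_zero]))
  have t : IsSl2Triple H E F := ⟨hH0, hEF,
    by rw [← Nat.cast_smul_eq_nsmul ℝ]; exact_mod_cast hHE,
    by rw [← Nat.cast_smul_eq_nsmul ℝ, ← neg_smul]; exact_mod_cast hHF⟩
  obtain ⟨v, μ, hv0, hEv, hHv⟩ : ∃ (v : V) (μ : ℝ), v ≠ 0 ∧ E v = 0 ∧ H v = μ • v := by
    obtain ⟨N, hN⟩ := nilp_aux H F (-2) (by norm_num) hHF
    obtain ⟨M, hM⟩ := nilp_aux H E 2 (by norm_num) hHE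
    obtain ⟨w, hw0, hw⟩ : ∃ w : V, w ≠ 0 ∧ E w = 0 := by
      by_contra! hcon
      have hi : Function.Injective E := (injective_iff_map_eq_zero E).mpr fun a ha => by
        by_contra hne; exact hcon a hne ha
      obtain ⟨x, hx⟩ := exists_ne (0 : V)
      have := hi.iterate M
      rw [← Module.End.coe_pow, hM] at this
      exact hx (this (by simp))
    exact prim_aux H E F hEF hHE hHF N w hw0 hw (by simp [hN])
  have P : t.HasPrimitiveVectorWith v μ := ⟨hv0, hHv, hEv⟩
  obtain ⟨n, hn⟩ := P.exists_nat
  have hne : ∀ i ≤ n, (F ^ i) v ≠ 0 := fun i hi => P.pow_toEnd_f_ne_zero_of_eq_nat hn hi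
  have hlast : (F ^ (n + 1)) v = 0 := P.pow_toEnd_f_eq_zero_of_eq_nat hn
  have hHi : ∀ i : ℕ, H ((F ^ i) v) = (μ - 2 * i) • (F ^ i) v := fun i => P.lie_h_pow_toEnd_f i
  have hEi : ∀ i : ℕ, E ((F ^ (i + 1)) v) = ((i + 1) * (μ - i)) • (F ^ i) v :=
    fun i => P.lie_e_pow_succ_toEnd_f i
  have hFi : ∀ i : ℕ, F ((F ^ i) v) = (F ^ (i + 1)) v := fun i => by rw [pow_succ']; rfl
  have hli : LinearIndependent ℝ (fun i : Fin (n + 1) => (F ^ (i : ℕ)) v) :=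
    Module.End.eigenvectors_linearIndependent' H (fun i : Fin (n + 1) => μ - 2 * ((i : ℕ) : ℝ))
      (fun a b hab => by
        apply Fin.ext
        have : ((a : ℕ) : ℝ) = (b : ℕ) := by simp only at hab; linarith
        exact_mod_cast this) _
      (fun i => ⟨by rw [Module.End.mem_eigenspace_iff]; exact hHi i, hne i (by omega)⟩)
  have hspan : Submodule.span ℝ (Set.range (fun i : Fin (n + 1) => (F ^ (i : ℕ)) v)) = ⊤ := by
    set W := Submodule.span ℝ (Set.range (fun i : Fin (n + 1) => (F ^ (i : ℕ)) v)) with hW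
    have hmem : ∀ i : ℕ, i ≤ n → (F ^ i) v ∈ W := fun i hi =>
      Submodule.subset_span ⟨⟨i, by omega⟩, rfl⟩
    have hstab : ∀ T : Module.End ℝ V, (∀ i ≤ n, T ((F ^ i) v) ∈ W) → ∀ w ∈ W, T w ∈ W := by
      intro T hT
      have : W ≤ W.comap T := by
        conv_lhs => rw [hW]
        rw [Submodule.span_le]
        rintro _ ⟨i, rfl⟩
        exact hT i (by omega)
      exact this
    have sH := hstab H fun i hi => by rw [hHi]; exact W.smul_mem _ (hmem i hi)
    have sF := hstab F fun i hi => by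
      rw [hFi]
      rcases Nat.lt_or_ge i n with h | h
      · exact hmem _ h
      · obtain rfl : i = n := by omega
        rw [hlast]; exact W.zero_mem
    have sE := hstab E fun i hi => by
      cases i with
      | zero => simp [hEv]
      | succ i => rw [hEi]; exact W.smul_mem _ (hmem i (by omega))
    refine (hirr W ?_).resolve_left ?_
    · intro A w hw
      obtain ⟨a, b, c, rfl⟩ := hdec A
      rw [map_add, map_add, map_smul, map_smul, map_smul, ← hE, ← hF, ← hH]
      exact W.add_mem (W.add_mem (W.smul_mem _ (sH w hw)) (W.smul_mem _ (sE w hw)))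
        (W.smul_mem _ (sF w hw))
    · intro hbot
      have := hmem 0 (by omega)
      rw [hbot] at this
      exact hv0 (by simpa using this)
  have hfr : finrank ℝ V = n + 1 := by
    rw [← finrank_top, ← hspan, finrank_span_eq_card hli, Fintype.card_fin]
  have horth : ∀ i j : ℕ, i + j ≠ n → B ((F ^ i) v) ((F ^ j) v) = 0 := by
    intro i j hij
    have := hskew h ((F ^ i) v) ((F ^ j) v)
    rw [← hH, hHi, hHi, hn] at this
    simp only [map_smul, LinearMap.smul_apply, smul_eq_mul] at this
    have h2 : (2 * ((n : ℝ) - (i + j))) * B ((F ^ i) v) ((F ^ j) v) = 0 := by linarith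
    refine (mul_eq_zero.mp h2).resolve_left fun h3 => hij ?_
    have : ((i + j : ℕ) : ℝ) = n := by push_cast; linarith
    exact_mod_cast this
  by_contra hcon
  have hn1 : n ≠ 2 := by omega
  have hsw : B (F v) v = B v (F v) := hsymm.eq (F v) v
  have hxy : B v (F v) = 0 := by
    have := hskew f v v
    rw [← hF] at this
    linarith
  have hx : B v v = 0 := by simpa using horth 0 0 (by omega)
  have hy : B (F v) (F v) = 0 := by simpa using horth 1 1 (by omega)
  obtain ⟨c, hc⟩ := lor_iso hdim B hB v (F v) hx hy hxy (hsw.trans hxy) hv0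
  have h1 := hHi 1
  simp only [pow_one, Nat.cast_one, mul_one] at h1
  have hne1 : F v ≠ 0 := by simpa using hne 1 (by omega)
  have h2 : H (F v) = μ • F v := by
    rw [hc, map_smul, hHv, smul_comm]
  rw [h2] at h1
  have h3 : (2 : ℝ) • F v = 0 := by
    have : (2 : ℝ) • F v = μ • F v - (μ - 2) • F v := by module
    rw [this, ← h1, sub_self]
  exact hne1 ((smul_eq_zero.mp h3).resolve_left (by norm_num))
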